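/- Let M = (m_ij) ∈ ℤ^{d×d} satisfy m_ii = 0, m_ik ≤ m_ij + m_jk for all i, j, k, and be in standard form (m_ij ≥ 0 for all i, j and m_ij + m_ji > 0 for i ≠ j). For each j let m^(j) ∈ ℤ^d denote the j-th column of M. Then X ∈ Λ_M if and only if for each j the j-th column of X lies in L_{m^(j)}, giving a direct sum decomposition Λ_M = L_{m^(1)} ⊕ ⋯ ⊕ L_{m^(d)} of O_K-modules; moreover each L_{m^(j)}, as a module over the ring Λ_M via matrix-vector multiplication, is a projective Λ_M-module. -/

import Mathlib

set_option synthInstance.maxHeartbeats 400000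
set_option maxHeartbeats 1600000

open scoped Pointwise

/-- The valuation ring `O_K` of a (surjective discrete) additive valuation on `K`. -/
def valRing {K : Type*} [Field K] (v : AddValuation K (WithTop ℤ)) : Subring K where
  carrier := {x | 0 ≤ v x}
  zero_mem' := by simp only [Set.mem_setOf_eq, v.map_zero]; exact le_top
  one_mem' := by simp only [Set.mem_setOf_eq, v.map_one, le_refl]
  add_mem' := fun {a b} ha hb => v.map_le_add ha hb
  mul_mem' := fun {a b} ha hb => by
    simp only [Set.mem_setOf_eq, v.map_mul] at *
    exact add_nonneg ha hb
  neg_mem' := fun {a} ha => by simpa only [Set.mem_setOf_eq, v.map_neg] using ha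

/-- The set `I_N = {X ∈ K^{d×d} : val(X) ≥ N}` (equal to `Λ_N` for suitable `N`). -/
def matSet {K : Type*} [Field K] (v : AddValuation K (WithTop ℤ)) {d : ℕ}
    (N : Matrix (Fin d) (Fin d) ℤ) : Set (Matrix (Fin d) (Fin d) K) :=
  {X | ∀ i j, (N i j : WithTop ℤ) ≤ v (X i j)}

/-- The diagonal lattice `L_u = {x ∈ K^d : val(x_i) ≥ u_i}` as a set. -/
def latSet {K : Type*} [Field K] (v : AddValuation K (WithTop ℤ)) {d : ℕ}
    (u : Fin d → ℤ) : Set (Fin d → K) :=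
  {x | ∀ i, (u i : WithTop ℤ) ≤ v (x i)}

/-- The diagonal lattice `L_u` as an `O_K`-submodule of `K^d`. -/
def latSub {K : Type*} [Field K] (v : AddValuation K (WithTop ℤ)) {d : ℕ}
    (u : Fin d → ℤ) : Submodule (valRing v) (Fin d → K) where
  carrier := latSet v u
  zero_mem' := fun i => by simp only [Pi.zero_apply, v.map_zero]; exact le_top
  add_mem' := fun {x y} hx hy i => v.map_le_add (hx i) (hy i)
  smul_mem' := fun c x hx i => by
    have hc : (0 : WithTop ℤ) ≤ v (c : K) := c.2
    have hcx : (c • x) i = (c : K) * x i := rfl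
    rw [hcx, v.map_mul]
    calc ((u i : ℤ) : WithTop ℤ) = 0 + (u i : ℤ) := by rw [zero_add]
      _ ≤ v (c : K) + v (x i) := add_le_add hc (hx i)

/-- The graduated order `Λ_M` as a subring of the matrix ring. -/
def lamSubring {K : Type*} [Field K] (v : AddValuation K (WithTop ℤ)) {d : ℕ}
    (M : Matrix (Fin d) (Fin d) ℤ) (hdiag : ∀ i, M i i = 0)
    (htri : ∀ i j k, M i k ≤ M i j + M j k) :
    Subring (Matrix (Fin d) (Fin d) K) where
  carrier := matSet v M
  zero_mem' := fun i j => by simp only [Matrix.zero_apply, v.map_zero]; exact le_top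
  one_mem' := fun i j => by
    rcases eq_or_ne i j with rfl | hij
    · rw [Matrix.one_apply_eq, v.map_one, hdiag i]
      exact_mod_cast le_refl (0 : ℤ)
    · simp only [Matrix.one_apply_ne hij, v.map_zero]; exact le_top
  add_mem' := fun {X Y} hX hY i j => v.map_le_add (hX i j) (hY i j)
  neg_mem' := fun {X} hX i j => by
    simpa only [Matrix.neg_apply, v.map_neg] using hX i j
  mul_mem' := fun {X Y} hX hY i k => by
    rw [Matrix.mul_apply]
    apply v.map_le_sum
    intro j _
    rw [v.map_mul]
    calc ((M i k : ℤ) : WithTop ℤ) ≤ ((M i j + M j k : ℤ) : WithTop ℤ) := by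
          exact_mod_cast htri i j k
      _ = ((M i j : ℤ) : WithTop ℤ) + ((M j k : ℤ) : WithTop ℤ) := by push_cast; rfl
      _ ≤ v (X i j) + v (Y j k) := add_le_add (hX i j) (hY j k)

/-- Matrix-vector multiplication makes `L_u` a module over `Λ_M`. -/
def latSMul {K : Type*} [Field K] (v : AddValuation K (WithTop ℤ)) {d : ℕ}
    (M : Matrix (Fin d) (Fin d) ℤ) (hdiag : ∀ i, M i i = 0)
    (htri : ∀ i j k, M i k ≤ M i j + M j k)
    (u : Fin d → ℤ) (hu : ∀ i j, u i - u j ≤ M i j) :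
    SMul (lamSubring v M hdiag htri) (latSub v u) :=
  ⟨fun X x => ⟨(X : Matrix (Fin d) (Fin d) K).mulVec (x : Fin d → K), by
    intro i
    show ((u i : ℤ) : WithTop ℤ) ≤
      v (∑ j, (X : Matrix (Fin d) (Fin d) K) i j * (x : Fin d → K) j)
    apply v.map_le_sum
    intro j _
    rw [v.map_mul]
    calc ((u i : ℤ) : WithTop ℤ) ≤ ((M i j + u j : ℤ) : WithTop ℤ) := by
          have := hu i j; exact_mod_cast by omega
      _ = ((M i j : ℤ) : WithTop ℤ) + ((u j : ℤ) : WithTop ℤ) := by push_cast; rfl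
      _ ≤ v ((X : Matrix (Fin d) (Fin d) K) i j) + v ((x : Fin d → K) j) :=
          add_le_add (X.2 i j) (x.2 j)⟩⟩

/-- The `Λ_M`-module structure on the diagonal lattice `L_u`,
given by matrix-vector multiplication. -/
def latModule {K : Type*} [Field K] (v : AddValuation K (WithTop ℤ)) {d : ℕ}
    (M : Matrix (Fin d) (Fin d) ℤ) (hdiag : ∀ i, M i i = 0)
    (htri : ∀ i j k, M i k ≤ M i j + M j k)
    (u : Fin d → ℤ) (hu : ∀ i j, u i - u j ≤ M i j) :
    Module (lamSubring v M hdiag htri) (latSub v u) :=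
  letI := latSMul v M hdiag htri u hu
  { one_smul := fun x => Subtype.ext (Matrix.one_mulVec (x : Fin d → K))
    mul_smul := fun X Y x => Subtype.ext
      ((Matrix.mulVec_mulVec (x : Fin d → K) (X : Matrix (Fin d) (Fin d) K)
        (Y : Matrix (Fin d) (Fin d) K)).symm)
    smul_zero := fun X => Subtype.ext (Matrix.mulVec_zero (X : Matrix (Fin d) (Fin d) K))
    smul_add := fun X x y => Subtype.ext
      (Matrix.mulVec_add (X : Matrix (Fin d) (Fin d) K) (x : Fin d → K) (y : Fin d → K))
    add_smul := fun X Y x => Subtype.ext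
      (Matrix.add_mulVec (X : Matrix (Fin d) (Fin d) K) (Y : Matrix (Fin d) (Fin d) K)
        (x : Fin d → K))
    zero_smul := fun x => Subtype.ext (Matrix.zero_mulVec (x : Fin d → K)) }

/-- The lattice `Λ_M` as an `O_K`-submodule of the matrix ring. -/
def lamSubmodule {K : Type*} [Field K] (v : AddValuation K (WithTop ℤ)) {d : ℕ}
    (M : Matrix (Fin d) (Fin d) ℤ) :
    Submodule (valRing v) (Matrix (Fin d) (Fin d) K) where
  carrier := matSet v M
  zero_mem' := fun i j => by simp only [Matrix.zero_apply, v.map_zero]; exact le_top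
  add_mem' := fun {X Y} hX hY i j => v.map_le_add (hX i j) (hY i j)
  smul_mem' := fun c X hX i j => by
    have hc : (0 : WithTop ℤ) ≤ v (c : K) := c.2
    have hcX : (c • X) i j = (c : K) * X i j := rfl
    rw [hcX, v.map_mul]
    calc ((M i j : ℤ) : WithTop ℤ) = 0 + (M i j : ℤ) := by rw [zero_add]
      _ ≤ v (c : K) + v (X i j) := add_le_add hc (hX i j)

/-- Reading off columns identifies `Λ_M` with the product of the lattices of the columns of `M`. -/
def columnEquiv {K : Type*} [Field K] (v : AddValuation K (WithTop ℤ)) {d : ℕ}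
    (M : Matrix (Fin d) (Fin d) ℤ) :
    lamSubmodule v M ≃ₗ[valRing v] (∀ j : Fin d, latSub v (fun i => M i j)) where
  toFun X j := ⟨fun i => (X : Matrix (Fin d) (Fin d) K) i j, fun i => X.2 i j⟩
  invFun x := ⟨fun i j => (x j : Fin d → K) i, fun i j => (x j).2 i⟩
  map_add' _ _ := rfl
  map_smul' _ _ := rfl
  left_inv _ := rfl
  right_inv _ := rfl

/-- The lattice of the `j`-th column of `M` is a direct summand of `Λ_M`, hence projective: the
inclusion as matrices supported in column `j` is split by reading off that column. -/
theorem projective_latSub_column {K : Type*} [Field K] (v : AddValuation K (WithTop ℤ)) {d : ℕ}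
    (M : Matrix (Fin d) (Fin d) ℤ) (hdiag : ∀ i, M i i = 0)
    (htri : ∀ i j k, M i k ≤ M i j + M j k) (j : Fin d)
    (hu : ∀ a b, M a j - M b j ≤ M a b) :
    @Module.Projective (lamSubring v M hdiag htri) _ (latSub v (fun i => M i j)) _
      (latModule v M hdiag htri (fun i => M i j) hu) := by
  let := latModule v M hdiag htri (fun i => M i j) hu
  let incl : latSub v (fun i => M i j) →ₗ[lamSubring v M hdiag htri] lamSubring v M hdiag htri :=
    { toFun := fun x => ⟨Matrix.updateCol 0 j (x : Fin d → K), fun a b => by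
        rw [Matrix.updateCol_apply]
        split_ifs with hb
        · exact hb ▸ x.2 a
        · simp only [Matrix.zero_apply, v.map_zero, le_top]⟩
      map_add' := fun x y => Subtype.ext <| by
        ext a b
        change Matrix.updateCol 0 j ((x : Fin d → K) + (y : Fin d → K)) a b =
          Matrix.updateCol 0 j (x : Fin d → K) a b + Matrix.updateCol 0 j (y : Fin d → K) a b
        simp only [Matrix.updateCol_apply]
        split_ifs <;> simp
      map_smul' := fun X x => Subtype.ext <| by
        change Matrix.updateCol 0 j ((X : Matrix (Fin d) (Fin d) K).mulVec (x : Fin d → K)) =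
          (X : Matrix (Fin d) (Fin d) K) * Matrix.updateCol 0 j (x : Fin d → K)
        ext a b
        simp only [Matrix.mul_apply, Matrix.updateCol_apply]
        split_ifs <;> simp [Matrix.mulVec, dotProduct] }
  let column : lamSubring v M hdiag htri →ₗ[lamSubring v M hdiag htri] latSub v (fun i => M i j) :=
    { toFun := fun X => ⟨fun i => (X : Matrix (Fin d) (Fin d) K) i j, fun i => X.2 i j⟩
      map_add' := fun _ _ => rfl
      map_smul' := fun _ _ => rfl }
  refine Module.Projective.of_split incl column ?_
  ext x a
  exact Matrix.updateCol_self

/-- Let `M` be a graduated-order matrix in standard form and let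
`m⁽ʲ⁾` be its `j`-th column. Then `X ∈ Λ_M` iff each column of `X` lies in `L_{m⁽ʲ⁾}`,
giving an `O_K`-linear direct-sum decomposition `Λ_M = L_{m⁽¹⁾} ⊕ ⋯ ⊕ L_{m⁽ᵈ⁾}`
(the column map is an `O_K`-linear equivalence onto the product); moreover each
`L_{m⁽ʲ⁾}` is a projective `Λ_M`-module. -/
theorem lam_column_decomposition_and_projective {K : Type*} [Field K]
    (v : AddValuation K (WithTop ℤ)) (hv : Function.Surjective v)
    (d : ℕ) (hd : 0 < d)
    (M : Matrix (Fin d) (Fin d) ℤ) (hdiag : ∀ i, M i i = 0)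
    (htri : ∀ i j k, M i k ≤ M i j + M j k)
    (hstd1 : ∀ i j, 0 ≤ M i j) (hstd2 : ∀ i j, i ≠ j → 0 < M i j + M j i) :
    (∀ X : Matrix (Fin d) (Fin d) K,
        X ∈ matSet v M ↔ ∀ j, (fun i => X i j) ∈ latSet v (fun i => M i j)) ∧
    (∃ e : lamSubmodule v M ≃ₗ[valRing v] (∀ j : Fin d, latSub v (fun i => M i j)),
        ∀ (X : lamSubmodule v M) (j i : Fin d),
          ((e X j : Fin d → K) i) = (X : Matrix (Fin d) (Fin d) K) i j) ∧
    (∀ j : Fin d,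
        @Module.Projective (lamSubring v M hdiag htri) _
          (latSub v (fun i => M i j)) _
          (latModule v M hdiag htri (fun i => M i j)
            (fun a b => by show M a j - M b j ≤ M a b; have := htri a b j; omega))) := by
  refine ⟨fun X => ⟨fun h j i => h i j, fun h i j => h j i⟩, ⟨columnEquiv v M, fun _ _ _ => rfl⟩,
    fun j => projective_latSub_column v M hdiag htri j _⟩
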